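/- arXiv:2208.10078 — 3 statements merged into one kernel-verified Lean document; each statement's English description precedes it below -/
import Mathlib

section
/- For every continuous f on [-1,1]^d, every k > 0, a ∈ ℝ^d and r ≥ 1, the FCCS rule admits the combination-technique representation I^{k,d,a,r} f = Σ_{ℓ ≥ 1, r ≤ |ℓ| ≤ r+d-1} (-1)^{r+d-|ℓ|-1} · binom(d-1, |ℓ|-r) · (I^{ω_1,ℓ_1} ⊗ ⋯ ⊗ I^{ω_d,ℓ_d}) f, where ω_j = k a_j, the sum is over multi-indices ℓ ∈ ℕ^d with all ℓ_j ≥ 1 and r ≤ ℓ_1+⋯+ℓ_d ≤ r+d-1, and the tensor product of 1D rules means the rule I^{ω_j,ℓ_j} is applied successively in the j-th variable. -/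
open MeasureTheory
open scoped Classical

noncomputable section

/-- `n_ℓ = 2^(ℓ-1)` (with `n_0 := 1` by ℕ-subtraction). -/
def nl (ℓ : ℕ) : ℕ := 2 ^ (ℓ - 1)

/-- The Clenshaw–Curtis points `t_{j,ℓ} = cos (jπ/n_ℓ)`. -/
def ccPoint (ℓ j : ℕ) : ℝ := Real.cos (j * Real.pi / nl ℓ)

/-- The 1D interpolation operator `Q^ℓ`: for `ℓ = 0` the zero operator, for `ℓ = 1`
the constant `g 0`, and for `ℓ ≥ 2` the polynomial of degree ≤ n_ℓ interpolating `g`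
at the Clenshaw–Curtis points of level ℓ. -/
def Qop (ℓ : ℕ) (g : ℝ → ℂ) : ℝ → ℂ :=
  if ℓ = 0 then 0
  else if ℓ = 1 then fun _ => g 0
  else fun y =>
    Polynomial.eval (y : ℂ)
      (Lagrange.interpolate (Finset.range (nl ℓ + 1)) (fun j => (ccPoint ℓ j : ℂ))
        (fun j => g (ccPoint ℓ j)))

/-- The difference operator `D^ℓ = Q^ℓ - Q^(ℓ-1)`. -/
def Dop (ℓ : ℕ) (g : ℝ → ℂ) : ℝ → ℂ := fun y => Qop ℓ g y - Qop (ℓ - 1) g y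

/-- `ã = a` if `k|a| ≥ 1`, else `0`. -/
def tilde (k a : ℝ) : ℝ := if 1 ≤ k * |a| then a else 0

/-- `â = a - ã`. -/
def hat (k a : ℝ) : ℝ := a - tilde k a

/-- `min {1, |ω|^{-s}}`, with the convention that it equals `1` when `ω = 0`. -/
def minOsc (ω : ℝ) (s : ℕ) : ℝ := if ω = 0 then 1 else min 1 (|ω|⁻¹ ^ s)

/-- Membership in `W^{p,1} = C^p[-1,1]`. -/
def MemW1 (p : ℕ) (g : ℝ → ℂ) : Prop :=
  ∀ j ≤ p, ContinuousOn (iteratedDeriv j g) (Set.Icc (-1 : ℝ) 1)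

/-- The norm on `W^{p,1}`. -/
def WNorm1 (p : ℕ) (g : ℝ → ℂ) : ℝ :=
  ⨆ j : Fin (p + 1), ⨆ y ∈ Set.Icc (-1 : ℝ) 1, ‖iteratedDeriv (j : ℕ) g y‖

/-- The 1D oscillatory integral `I^ω g = ∫_{-1}^1 g(y) e^{iωy} dy`. -/
def oscInt1 (ω : ℝ) (g : ℝ → ℂ) : ℂ :=
  ∫ y in (-1 : ℝ)..1, g y * Complex.exp (Complex.I * ((ω * y : ℝ) : ℂ))

/-- The combined 1D quadrature rule `I^{ω,ℓ}`: the Filon–Clenshaw–Curtis rule when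
`|ω| ≥ 1`, the Clenshaw–Curtis rule applied to the whole integrand when `|ω| < 1`. -/
def quadI (ω : ℝ) (ℓ : ℕ) (g : ℝ → ℂ) : ℂ :=
  if 1 ≤ |ω| then
    ∫ y in (-1 : ℝ)..1, Qop ℓ g y * Complex.exp (Complex.I * ((ω * y : ℝ) : ℂ))
  else
    ∫ y in (-1 : ℝ)..1, Qop ℓ (fun t => g t * Complex.exp (Complex.I * ((ω * t : ℝ) : ℂ))) y

/-- The cube `[-1,1]^d`. -/
def cube (d : ℕ) : Set (Fin d → ℝ) := Set.Icc (fun _ => (-1 : ℝ)) (fun _ => 1)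

/-- Partial derivative in the `j`-th coordinate. -/
def partialD (d : ℕ) (j : Fin d) (g : (Fin d → ℝ) → ℂ) : (Fin d → ℝ) → ℂ :=
  fun y => deriv (fun t => g (Function.update y j t)) (y j)

/-- The mixed partial derivative `∂^{|s|} g / ∂y^s`. -/
def mixedD (d : ℕ) (s : Fin d → ℕ) (g : (Fin d → ℝ) → ℂ) : (Fin d → ℝ) → ℂ :=
  (List.finRange d).foldr (fun j acc => (partialD d j)^[s j] acc) g

/-- Membership in `W^{p,d}`: all mixed partials of order `|s|_∞ ≤ p` are continuous
on `[-1,1]^d`. -/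
def MemW (d p : ℕ) (f : (Fin d → ℝ) → ℂ) : Prop :=
  ∀ s : Fin d → ℕ, (∀ j, s j ≤ p) → ContinuousOn (mixedD d s f) (cube d)

/-- The norm on `W^{p,d}`. -/
def WNormD (d p : ℕ) (f : (Fin d → ℝ) → ℂ) : ℝ :=
  ⨆ s : Fin d → Fin (p + 1), ⨆ y ∈ cube d, ‖mixedD d (fun j => (s j : ℕ)) f y‖

/-- Apply a 1D operator `T` in the `j`-th variable of a multivariate function. -/
def applyIn (d : ℕ) (j : Fin d) (T : (ℝ → ℂ) → ℝ → ℂ) (g : (Fin d → ℝ) → ℂ) :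
    (Fin d → ℝ) → ℂ :=
  fun y => T (fun t => g (Function.update y j t)) (y j)

/-- The tensor-product operator `D^{ℓ_1} ⊗ ⋯ ⊗ D^{ℓ_d}`. -/
def tensorD (d : ℕ) (lv : Fin d → ℕ) (f : (Fin d → ℝ) → ℂ) : (Fin d → ℝ) → ℂ :=
  (List.finRange d).foldr (fun j acc => applyIn d j (Dop (lv j)) acc) f

/-- The Smolyak index set `Λ(r+d-1, d)` (components encoded in `Fin (r+d)`). -/
def smolyakIdx (d r : ℕ) : Finset (Fin d → Fin (r + d)) :=
  Finset.univ.filter (fun s => (∀ j, 1 ≤ (s j : ℕ)) ∧ (∑ j, (s j : ℕ)) ≤ r + d - 1)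

/-- The Smolyak interpolation operator `Q^{r,d}` of maximum level `r`. -/
def smolyakQ (d r : ℕ) (f : (Fin d → ℝ) → ℂ) : (Fin d → ℝ) → ℂ :=
  ∑ s ∈ smolyakIdx d r, tensorD d (fun j => (s j : ℕ)) f

/-- The multi-dimensional oscillatory integral `I^{k,d,a} f`. -/
def oscIntD (d : ℕ) (k : ℝ) (a : Fin d → ℝ) (f : (Fin d → ℝ) → ℂ) : ℂ :=
  ∫ y in cube d, f y * Complex.exp (Complex.I * ((k * ∑ j, a j * y j : ℝ) : ℂ))

/-- `f̂(y) = f(y) exp(i k â ⬝ y)`. -/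
def fhatD (d : ℕ) (k : ℝ) (a : Fin d → ℝ) (f : (Fin d → ℝ) → ℂ) : (Fin d → ℝ) → ℂ :=
  fun y => f y * Complex.exp (Complex.I * ((k * ∑ j, hat k (a j) * y j : ℝ) : ℂ))

/-- The Filon–Clenshaw–Curtis–Smolyak rule `I^{k,d,a,r} f`. -/
def fccs (d : ℕ) (k : ℝ) (a : Fin d → ℝ) (r : ℕ) (f : (Fin d → ℝ) → ℂ) : ℂ :=
  oscIntD d k (fun j => tilde k (a j)) (smolyakQ d r (fhatD d k a f))

/-- The 1D grid of level ℓ. -/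
def grid1 (ℓ : ℕ) : Finset ℝ :=
  if ℓ ≤ 1 then {0} else (Finset.range (nl ℓ + 1)).image (fun j => ccPoint ℓ j)

/-- The sparse grid used by `Q^{r,d}`. -/
def sparseGrid (d r : ℕ) : Finset (Fin d → ℝ) :=
  (smolyakIdx d r).biUnion (fun s => Fintype.piFinset (fun j => grid1 (s j)))

/-- `N(r,d)`: the number of distinct interpolation points used by `Q^{r,d}`. -/
def numPts (d r : ℕ) : ℕ := (sparseGrid d r).card

/-- The tensor product `I^{ω_1,ℓ_1} ⊗ ⋯ ⊗ I^{ω_d,ℓ_d}` of 1D quadrature rules,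
applied successively in each variable. -/
def tensorQuad : (d : ℕ) → (Fin d → ℝ) → (Fin d → ℕ) → ((Fin d → ℝ) → ℂ) → ℂ
  | 0, _, _, f => f fun i => i.elim0
  | d + 1, ω, L, f =>
      tensorQuad d (fun j => ω j.castSucc) (fun j => L j.castSucc)
        (fun y => quadI (ω (Fin.last d)) (L (Fin.last d)) (fun t => f (Fin.snoc y t)))

end

section Combinatorics

open PowerSeries

lemma coeff_one_sub_X_pow (e n : ℕ) :
    coeff n ((1 - X : PowerSeries ℂ) ^ e) = (-1) ^ n * (e.choose n : ℂ) := by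
  have h : (1 - X : PowerSeries ℂ) ^ e = rescale (-1) (((1 + Polynomial.X) ^ e : Polynomial ℂ) :
      PowerSeries ℂ) := by
    simp [rescale_X, sub_eq_add_neg]
  rw [h, coeff_rescale, Polynomial.coeff_coe, Polynomial.coeff_one_add_X_pow]

/-- The Cauchy product of `d` power series, as a sum over exponents bounded by `N`. -/
lemma coeff_prod_fin {d N n : ℕ} (hn : n < N) (P : Fin d → PowerSeries ℂ) :
    coeff n (∏ j, P j) =
      ∑ s : Fin d → Fin N with ∑ j, (s j : ℕ) = n, ∏ j, coeff (s j : ℕ) (P j) := by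
  rw [coeff_prod]
  symm
  refine Finset.sum_bij' (fun s _ => Finsupp.equivFunOnFinite.symm fun j => (s j : ℕ))
    (fun l hl j => ⟨l j, ?_⟩) ?_ ?_ ?_ ?_ ?_
  · have hs := (Finset.mem_finsuppAntidiag.1 hl).1
    exact ((Finset.single_le_sum (f := l) (fun _ _ => Nat.zero_le _)
      (Finset.mem_univ j)).trans hs.le).trans_lt hn
  · intro s hs
    simpa using hs
  · intro l hl
    simpa using (Finset.mem_finsuppAntidiag.1 hl).1
  · intro s _
    ext j
    simp
  · intro l _
    ext j
    simp
  · intro s _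
    simp

lemma coeff_one_sub_X_mul_mk (A : ℕ → ℂ) (hA : A 0 = 0) (n : ℕ) :
    coeff n ((1 - X) * mk A) = A n - A (n - 1) := by
  cases n with
  | zero => simp [sub_mul, hA]
  | succ n => simp [sub_mul, coeff_succ_X_mul]

lemma coeff_mul_mk_one (P : PowerSeries ℂ) (n : ℕ) :
    coeff n (P * mk 1) = ∑ m ∈ Finset.range (n + 1), coeff m P := by
  rw [coeff_mul, Finset.Nat.sum_antidiagonal_eq_sum_range_succ_mk]
  simp

/-- The combination formula for sums of tensor products of differences. -/
lemma sum_prod_differences {d r : ℕ} (hd : 1 ≤ d) (A : Fin d → ℕ → ℂ) (hA : ∀ j, A j 0 = 0) :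
    ∑ s ∈ smolyakIdx d r, ∏ j, (A j (s j) - A j (s j - 1)) =
      ∑ s ∈ Finset.univ.filter (fun s : Fin d → Fin (r + d) =>
          (∀ j, 1 ≤ (s j : ℕ)) ∧ r ≤ (∑ j, (s j : ℕ)) ∧ (∑ j, (s j : ℕ)) ≤ r + d - 1),
        (-1 : ℂ) ^ (r + d - (∑ j, (s j : ℕ)) - 1) *
          ((d - 1).choose ((∑ j, (s j : ℕ)) - r) : ℂ) * ∏ j, A j (s j) := by
  set n := r + d - 1 with hn
  have hL : ∑ s ∈ smolyakIdx d r, ∏ j, (A j (s j) - A j (s j - 1)) =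
      coeff n ((∏ j, ((1 - X) * mk (A j))) * mk 1) := by
    rw [coeff_mul_mk_one]
    have h1 : ∀ m ∈ Finset.range (n + 1), coeff m (∏ j, ((1 - X) * mk (A j))) =
        ∑ s : Fin d → Fin (r + d) with ∑ j, (s j : ℕ) = m, ∏ j, (A j (s j) - A j (s j - 1)) := by
      intro m hm
      rw [Finset.mem_range] at hm
      rw [coeff_prod_fin (N := r + d) (by omega)]
      simp_rw [coeff_one_sub_X_mul_mk _ (hA _)]
    rw [Finset.sum_congr rfl h1]
    rw [← Finset.sum_fiberwise_of_maps_to (s := smolyakIdx d r) (t := Finset.range (n + 1))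
      (g := fun s => ∑ j, (s j : ℕ))]
    · refine Finset.sum_congr rfl fun m hm => ?_
      refine Finset.sum_subset ?_ ?_
      · intro s hs
        simp only [Finset.mem_filter] at hs
        simp [hs.2]
      · intro s hs hs'
        simp only [smolyakIdx, Finset.mem_filter, Finset.mem_univ, true_and, not_and] at hs hs'
        rw [Finset.mem_range] at hm
        have : ¬ ∀ j, 1 ≤ (s j : ℕ) := fun h => hs' ⟨h, by omega⟩ hs
        push Not at this
        obtain ⟨j, hj⟩ := this
        refine Finset.prod_eq_zero (Finset.mem_univ j) ?_
        have : (s j : ℕ) = 0 := by omega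
        simp [this]
    · intro s hs
      simp only [smolyakIdx, Finset.mem_filter] at hs
      simp only [Finset.mem_range]
      omega
  have hP : (∏ j, ((1 - X) * mk (A j))) * mk 1 = (1 - X) ^ (d - 1) * ∏ j, mk (A j) := by
    obtain ⟨e, rfl⟩ : ∃ e, d = e + 1 := ⟨d - 1, by omega⟩
    rw [Finset.prod_mul_distrib, Finset.prod_const, Finset.card_univ, Fintype.card_fin,
      add_tsub_cancel_right, pow_succ]
    linear_combination ((1 - X) ^ e * ∏ j, mk (A j)) * mk_one_mul_one_sub_eq_one ℂ
  rw [hL, hP, mul_comm, coeff_mul, Finset.Nat.sum_antidiagonal_eq_sum_range_succ_mk]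
  have h2 : ∀ m ∈ Finset.range n.succ,
      coeff m (∏ j, mk (A j)) * coeff (n - m) ((1 - X : PowerSeries ℂ) ^ (d - 1)) =
        ∑ s : Fin d → Fin (r + d) with ∑ j, (s j : ℕ) = m,
          (-1) ^ (n - ∑ j, (s j : ℕ)) * ((d - 1).choose (n - ∑ j, (s j : ℕ)) : ℂ) *
            ∏ j, A j (s j) := by
    intro m hm
    rw [Finset.mem_range] at hm
    rw [coeff_prod_fin (N := r + d) (by omega), coeff_one_sub_X_pow, Finset.sum_mul]
    refine Finset.sum_congr rfl fun s hs => ?_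
    rw [(Finset.mem_filter.1 hs).2]
    simp only [coeff_mk]
    ring
  rw [Finset.sum_congr rfl h2]
  symm
  rw [← Finset.sum_fiberwise_of_maps_to (t := Finset.range n.succ)
      (g := fun s : Fin d → Fin (r + d) => ∑ j, (s j : ℕ))]
  · refine Finset.sum_congr rfl fun m hm => ?_
    rw [Finset.mem_range] at hm
    trans ∑ s ∈ Finset.filter (fun s : Fin d → Fin (r + d) => ∑ j, (s j : ℕ) = m)
        (Finset.univ.filter (fun s : Fin d → Fin (r + d) =>
          (∀ j, 1 ≤ (s j : ℕ)) ∧ r ≤ (∑ j, (s j : ℕ)) ∧ (∑ j, (s j : ℕ)) ≤ n)),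
          (-1) ^ (n - ∑ j, (s j : ℕ)) * ((d - 1).choose (n - ∑ j, (s j : ℕ)) : ℂ) *
            ∏ j, A j (s j)
    · refine Finset.sum_congr rfl fun s hs => ?_
      simp only [Finset.mem_filter, Finset.mem_univ, true_and] at hs
      rw [← Nat.choose_symm (n := d - 1) (k := n - ∑ j, (s j : ℕ)) (by omega),
        show r + d - (∑ j, (s j : ℕ)) - 1 = n - ∑ j, (s j : ℕ) by omega,
        show d - 1 - (n - ∑ j, (s j : ℕ)) = (∑ j, (s j : ℕ)) - r by omega]
    · refine Finset.sum_subset ?_ ?_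
      · intro s hs
        simp only [Finset.mem_filter] at hs
        simp [hs.2]
      · intro s hs hs'
        simp only [Finset.mem_filter, Finset.mem_univ, true_and, not_and] at hs hs'
        by_cases h : ∀ j, 1 ≤ (s j : ℕ)
        · have hlt : ∑ j, (s j : ℕ) < r := by
            by_contra hr
            exact hs' ⟨h, by omega, by omega⟩ hs
          rw [Nat.choose_eq_zero_of_lt (by omega)]
          simp
        · push Not at h
          obtain ⟨j, hj⟩ := h
          have h0 : (s j : ℕ) = 0 := by omega
          rw [Finset.prod_eq_zero (Finset.mem_univ j) (by rw [h0, hA]), mul_zero]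
  · intro s hs
    simp only [Finset.mem_filter] at hs
    simp only [Finset.mem_range]
    omega

end Combinatorics

section Interpolation

/-- The function equal to `1` at `x` and `0` elsewhere. -/
noncomputable def pointMass (x : ℝ) : ℝ → ℂ := fun t => if t = x then 1 else 0

lemma sum_mul_pointMass {S : Finset ℝ} {t : ℝ} (ht : t ∈ S) (g : ℝ → ℂ) :
    ∑ x ∈ S, g x * pointMass x t = g t := by
  simp [pointMass, ht]

lemma Qop_eq_sum {ℓ : ℕ} {S : Finset ℝ} (hS : grid1 ℓ ⊆ S) (g : ℝ → ℂ) (y : ℝ) :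
    Qop ℓ g y = ∑ x ∈ S, g x * Qop ℓ (pointMass x) y := by
  by_cases h0 : ℓ = 0
  · simp [Qop, h0]
  by_cases h1 : ℓ = 1
  · subst h1
    simpa [Qop] using (sum_mul_pointMass (hS (by simp [grid1])) g).symm
  · simp only [Qop, h0, h1, if_false, Lagrange.interpolate_apply, Polynomial.eval_finsetSum,
      Polynomial.eval_mul, Polynomial.eval_C, Finset.mul_sum]
    rw [Finset.sum_comm]
    refine Finset.sum_congr rfl fun i hi => ?_
    have hmem : ccPoint ℓ i ∈ S := by
      refine hS ?_
      rw [grid1, if_neg (by omega)]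
      exact Finset.mem_image_of_mem _ hi
    rw [← sum_mul_pointMass hmem g, Finset.sum_mul]
    exact Finset.sum_congr rfl fun x _ => by ring

lemma Qop_pointMass_mul (ℓ : ℕ) (x : ℝ) (h : ℝ → ℂ) (y : ℝ) :
    Qop ℓ (fun t => pointMass x t * h t) y = h x * Qop ℓ (pointMass x) y := by
  rw [Qop_eq_sum (Finset.subset_insert x (grid1 ℓ)),
    Finset.sum_eq_single_of_mem x (Finset.mem_insert_self _ _)]
  · simp [pointMass]
  · intro z _ hz
    simp [pointMass, hz]

lemma continuous_Qop (ℓ : ℕ) (g : ℝ → ℂ) : Continuous (Qop ℓ g) := by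
  unfold Qop
  split_ifs
  · exact continuous_const
  · exact continuous_const
  · exact (Polynomial.continuous _).comp Complex.continuous_ofReal

lemma continuous_Dop (ℓ : ℕ) (g : ℝ → ℂ) : Continuous (Dop ℓ g) :=
  (continuous_Qop ℓ g).sub (continuous_Qop (ℓ - 1) g)

lemma Dop_eq_sum {ℓ : ℕ} {S : Finset ℝ} (hS : grid1 ℓ ⊆ S) (hS' : grid1 (ℓ - 1) ⊆ S)
    (g : ℝ → ℂ) (y : ℝ) :
    Dop ℓ g y = ∑ x ∈ S, g x * Dop ℓ (pointMass x) y := by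
  simp_rw [Dop, mul_sub, Finset.sum_sub_distrib]
  rw [Qop_eq_sum hS, Qop_eq_sum hS']

/-- Successive application of one-dimensional operators with nodes in `S`, as a sum over the
product grid. -/
lemma foldr_applyIn_eq_sum {d : ℕ} {S : Finset ℝ} {T : Fin d → (ℝ → ℂ) → ℝ → ℂ}
    (hT : ∀ j g y, T j g y = ∑ x ∈ S, g x * T j (pointMass x) y)
    (f : (Fin d → ℝ) → ℂ) {l : List (Fin d)} (hl : l.Nodup) (y : Fin d → ℝ)
    (hy : ∀ j, j ∉ l → y j ∈ S) :
    l.foldr (fun j acc => applyIn d j (T j) acc) f y =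
      ∑ x ∈ Fintype.piFinset fun _ => S,
        f x * ∏ j, if j ∈ l then T j (pointMass (x j)) (y j) else pointMass (x j) (y j) := by
  induction l generalizing y with
  | nil =>
    rw [Finset.sum_eq_single_of_mem y (Fintype.mem_piFinset.2 fun j => hy j List.not_mem_nil)]
    · simp [pointMass]
    · intro x _ hx
      obtain ⟨j, hj⟩ := Function.ne_iff.1 hx
      rw [Finset.prod_eq_zero (Finset.mem_univ j), mul_zero]
      simp [pointMass, hj.symm]
  | cons j l ih =>
    rw [List.nodup_cons] at hl
    rw [List.foldr_cons, applyIn, hT]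
    have key : ∀ t ∈ S, l.foldr (fun j acc => applyIn d j (T j) acc) f (Function.update y j t) =
        ∑ x ∈ Fintype.piFinset fun _ => S, f x * (pointMass (x j) t *
          ∏ i ∈ Finset.univ.erase j,
            if i ∈ j :: l then T i (pointMass (x i)) (y i) else pointMass (x i) (y i)) := by
      intro t ht
      rw [ih hl.2]
      · refine Finset.sum_congr rfl fun x _ => ?_
        rw [← Finset.mul_prod_erase _ _ (Finset.mem_univ j), if_neg hl.1, Function.update_self]
        congr 2
        refine Finset.prod_congr rfl fun i hi => ?_
        have hij := Finset.ne_of_mem_erase hi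
        simp [hij]
      · intro i hi
        by_cases hij : i = j
        · subst hij
          simpa using ht
        · rw [Function.update_of_ne hij]
          exact hy i (by simp [hij, hi])
    rw [Finset.sum_congr rfl fun t ht => by rw [key t ht]]
    simp_rw [Finset.sum_mul]
    rw [Finset.sum_comm]
    refine Finset.sum_congr rfl fun x hx => ?_
    rw [← Finset.mul_prod_erase _ _ (Finset.mem_univ j), if_pos List.mem_cons_self,
      Finset.sum_eq_single_of_mem (x j) (Fintype.mem_piFinset.1 hx j)]
    · simp only [pointMass, if_true]
      ring
    · intro t _ ht
      simp [pointMass, ht]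

lemma tensorD_eq_sum {d : ℕ} {S : Finset ℝ} {L : Fin d → ℕ} (hS : ∀ j, grid1 (L j) ⊆ S)
    (hS' : ∀ j, grid1 (L j - 1) ⊆ S) (f : (Fin d → ℝ) → ℂ) (y : Fin d → ℝ) :
    tensorD d L f y =
      ∑ x ∈ Fintype.piFinset fun _ => S, f x * ∏ j, Dop (L j) (pointMass (x j)) (y j) := by
  rw [tensorD, foldr_applyIn_eq_sum (fun j => Dop_eq_sum (hS j) (hS' j)) f (List.nodup_finRange d)
    y (fun j hj => absurd (List.mem_finRange j) hj)]
  simp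

end Interpolation

section Quadrature

/-- The oscillatory factor `exp (iωy)`. -/
noncomputable def phase (ω y : ℝ) : ℂ := Complex.exp (Complex.I * ((ω * y : ℝ) : ℂ))

lemma continuous_phase (ω : ℝ) : Continuous (phase ω) := by
  unfold phase
  fun_prop

lemma prod_phase {d : ℕ} (k : ℝ) (b y : Fin d → ℝ) :
    Complex.exp (Complex.I * ((k * ∑ j, b j * y j : ℝ) : ℂ)) = ∏ j, phase (k * b j) (y j) := by
  simp only [phase, ← Complex.exp_sum, ← Finset.mul_sum, ← Complex.ofReal_sum]
  simp only [Finset.mul_sum, mul_assoc]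

lemma quadI_eq_integral {k : ℝ} (hk : 0 < k) (a : ℝ) (ℓ : ℕ) (g : ℝ → ℂ) :
    quadI (k * a) ℓ g = ∫ y in (-1 : ℝ)..1,
      Qop ℓ (fun t => g t * phase (k * hat k a) t) y * phase (k * tilde k a) y := by
  rw [quadI, abs_mul, abs_of_pos hk]
  split_ifs with h <;> simp [hat, tilde, h, phase]

lemma quadI_zero (ω : ℝ) (g : ℝ → ℂ) : quadI ω 0 g = 0 := by
  simp [quadI, Qop]

lemma quadI_pointMass {k : ℝ} (hk : 0 < k) (a : ℝ) (ℓ : ℕ) (x : ℝ) :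
    quadI (k * a) ℓ (pointMass x) = phase (k * hat k a) x *
      ∫ y in (-1 : ℝ)..1, Qop ℓ (pointMass x) y * phase (k * tilde k a) y := by
  simp_rw [quadI_eq_integral hk, Qop_pointMass_mul, mul_assoc, intervalIntegral.integral_const_mul]

lemma phase_mul_integral_Dop {k : ℝ} (hk : 0 < k) (a : ℝ) (ℓ : ℕ) (x : ℝ) :
    phase (k * hat k a) x *
        ∫ y in (-1 : ℝ)..1, Dop ℓ (pointMass x) y * phase (k * tilde k a) y =
      quadI (k * a) ℓ (pointMass x) - quadI (k * a) (ℓ - 1) (pointMass x) := by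
  have hint : ∀ m, IntervalIntegrable
      (fun y => Qop m (pointMass x) y * phase (k * tilde k a) y) volume (-1) 1 := fun m =>
    ((continuous_Qop _ _).mul (continuous_phase _)).intervalIntegrable _ _
  simp_rw [quadI_pointMass hk, ← mul_sub, Dop, sub_mul,
    intervalIntegral.integral_sub (hint ℓ) (hint (ℓ - 1))]

lemma quadI_eq_sum (ω : ℝ) {ℓ : ℕ} {S : Finset ℝ} (hS : grid1 ℓ ⊆ S) (g : ℝ → ℂ) :
    quadI ω ℓ g = ∑ x ∈ S, g x * quadI ω ℓ (pointMass x) := by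
  rw [← one_mul ω]
  simp_rw [quadI_pointMass one_pos, quadI_eq_integral one_pos ω ℓ g,
    Qop_eq_sum hS (fun t => g t * _), Finset.sum_mul, mul_assoc]
  rw [intervalIntegral.integral_finsetSum]
  · simp_rw [intervalIntegral.integral_const_mul]
  · intro x _
    exact (((continuous_Qop _ _).mul (continuous_phase _)).const_mul _ |>.const_mul _
      ).intervalIntegrable _ _

lemma tensorQuad_eq_sum {d : ℕ} (ω : Fin d → ℝ) {L : Fin d → ℕ} {S : Finset ℝ}
    (hS : ∀ j, grid1 (L j) ⊆ S) (f : (Fin d → ℝ) → ℂ) :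
    tensorQuad d ω L f =
      ∑ x ∈ Fintype.piFinset fun _ => S, f x * ∏ j, quadI (ω j) (L j) (pointMass (x j)) := by
  induction d with
  | zero =>
    simp only [tensorQuad, Finset.univ_eq_empty, Finset.prod_empty, mul_one]
    rw [Finset.sum_eq_single_of_mem (fun i => i.elim0) (Fintype.mem_piFinset.2 fun i => i.elim0)]
    intro x _ hx
    exact absurd (Subsingleton.elim _ _) hx
  | succ d ih =>
    rw [tensorQuad, ih _ fun j => hS j.castSucc]
    simp_rw [quadI_eq_sum (ω (Fin.last d)) (hS (Fin.last d)) (fun t => f _), Finset.sum_mul]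
    rw [← Finset.sum_product_right']
    refine Finset.sum_equiv (Fin.snocEquiv fun _ => ℝ) ?_ ?_
    · rintro ⟨t, x⟩
      simp [Fin.snocEquiv, Fin.forall_fin_succ', and_comm]
    · rintro ⟨t, x⟩ _
      simp only [Fin.snocEquiv, Equiv.coe_fn_mk, Fin.prod_univ_castSucc, Fin.snoc_castSucc,
        Fin.snoc_last]
      ring

lemma integral_cube_prod {d : ℕ} (h : Fin d → ℝ → ℂ) :
    ∫ y in cube d, ∏ j, h j (y j) = ∏ j, ∫ t in (-1 : ℝ)..1, h j t := by
  rw [cube, ← Set.pi_univ_Icc, volume_pi, Measure.restrict_pi_pi, integral_fintype_prod_eq_prod]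
  refine Finset.prod_congr rfl fun j _ => ?_
  rw [intervalIntegral.integral_of_le (by norm_num), integral_Icc_eq_integral_Ioc]

end Quadrature


/-- Proposition 3.2 of the paper: the combination-technique
representation of the FCCS rule in terms of tensor products of 1D rules. -/
theorem fccs_combination (d : ℕ) (hd : 1 ≤ d) (k : ℝ) (hk : 0 < k) (a : Fin d → ℝ)
    (r : ℕ) (hr : 1 ≤ r) (f : (Fin d → ℝ) → ℂ) (hf : ContinuousOn f (cube d)) :
    fccs d k a r f =
      ∑ s ∈ Finset.univ.filter (fun s : Fin d → Fin (r + d) =>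
          (∀ j, 1 ≤ (s j : ℕ)) ∧ r ≤ (∑ j, (s j : ℕ)) ∧ (∑ j, (s j : ℕ)) ≤ r + d - 1),
        (-1 : ℂ) ^ (r + d - (∑ j, (s j : ℕ)) - 1) *
          ((d - 1).choose ((∑ j, (s j : ℕ)) - r) : ℂ) *
          tensorQuad d (fun j => k * a j) (fun j => (s j : ℕ)) f := by
  set S : Finset ℝ := (Finset.range (r + d)).biUnion grid1
  have hS : ∀ ℓ < r + d, grid1 ℓ ⊆ S := fun ℓ hℓ =>
    Finset.subset_biUnion_of_mem grid1 (Finset.mem_range.2 hℓ)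
  have hintegrand : ∀ y, smolyakQ d r (fhatD d k a f) y *
      Complex.exp (Complex.I * ((k * ∑ j, tilde k (a j) * y j : ℝ) : ℂ)) =
      ∑ s ∈ smolyakIdx d r, ∑ x ∈ Fintype.piFinset fun _ => S, fhatD d k a f x *
        ∏ j, (Dop (s j) (pointMass (x j)) (y j) * phase (k * tilde k (a j)) (y j)) := by
    intro y
    rw [prod_phase, smolyakQ, Finset.sum_apply, Finset.sum_mul]
    refine Finset.sum_congr rfl fun s _ => ?_
    rw [tensorD_eq_sum (S := S) (fun j => hS _ (s j).2)
      (fun j => hS _ (lt_of_le_of_lt (Nat.sub_le _ _) (s j).2)), Finset.sum_mul]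
    simp_rw [Finset.prod_mul_distrib, mul_assoc]
  have hcube : IsCompact (cube d) := isCompact_Icc
  have hint : ∀ (s : Fin d → Fin (r + d)) (x : Fin d → ℝ), IntegrableOn (fun y => fhatD d k a f x *
      ∏ j, (Dop (s j) (pointMass (x j)) (y j) * phase (k * tilde k (a j)) (y j))) (cube d) := by
    intro s x
    refine Continuous.continuousOn ?_ |>.integrableOn_compact hcube
    refine continuous_const.mul (continuous_finsetProd _ fun j _ => ?_)
    exact ((continuous_Dop _ _).mul (continuous_phase _)).comp (continuous_apply j)
  have hterm : ∀ (s : Fin d → Fin (r + d)) (x : Fin d → ℝ), ∫ y in cube d, fhatD d k a f x *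
      ∏ j, (Dop (s j) (pointMass (x j)) (y j) * phase (k * tilde k (a j)) (y j)) =
      f x * ∏ j, (quadI (k * a j) (s j) (pointMass (x j)) -
        quadI (k * a j) (s j - 1) (pointMass (x j))) := by
    intro s x
    rw [integral_const_mul, integral_cube_prod
      (fun j t => Dop (s j) (pointMass (x j)) t * phase (k * tilde k (a j)) t), fhatD, prod_phase,
      mul_assoc, ← Finset.prod_mul_distrib]
    simp_rw [phase_mul_integral_Dop hk]
  rw [fccs, oscIntD]
  simp_rw [hintegrand]
  rw [integral_finsetSum _ fun s _ => integrable_finsetSum _ fun x _ => hint s x]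
  simp_rw [integral_finsetSum _ fun x _ => hint _ x, hterm]
  rw [Finset.sum_comm]
  simp_rw [tensorQuad_eq_sum _ (fun j => hS _ (Fin.is_lt _)), Finset.mul_sum]
  conv_rhs => rw [Finset.sum_comm]
  refine Finset.sum_congr rfl fun x _ => ?_
  rw [← Finset.mul_sum, sum_prod_differences hd
    (fun j ℓ => quadI (k * a j) ℓ (pointMass (x j))) (fun j => quadI_zero _ _), Finset.mul_sum]
  exact Finset.sum_congr rfl fun s _ => by ring
end

section
/- Let k > 0, n ∈ C^1[0,1] real-valued, N(x) = ∫_0^x n, ξ = exp(ikN). Let m ≥ 0 and let μ_j, ν_j ∈ C^2[0,1] for j = 0,…,2m satisfy the recurrences 2nμ_j' + n'μ_j = i μ_{j-1}'' and 2nν_j' + n'ν_j = −i ν_{j-1}'' for j = 0,…,2m, with μ_{-1} = ν_{-1} = 0. Set r_j = μ_j ξ + ν_j ξ^{-1}. Then on [0,1], (Σ_{j=0}^{2m} k^{-j} r_j)'' + k² n² (Σ_{j=0}^{2m} k^{-j} r_j) = k^{-2m} (μ_{2m}'' ξ + ν_{2m}'' ξ^{-1}). -/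
open MeasureTheory

noncomputable section

/-- `N(x) = ∫_0^x n(x') dx'`. -/
def Nint (n : ℝ → ℝ) (x : ℝ) : ℝ := ∫ t in (0:ℝ)..x, n t

/-- `ξ(x) = exp(i k N(x))`. -/
def xiF (k : ℝ) (n : ℝ → ℝ) (x : ℝ) : ℂ := Complex.exp (Complex.I * ((k * Nint n x : ℝ) : ℂ))

/-- `ξ^{-1}(x) = exp(-i k N(x))`. -/
def xiInv (k : ℝ) (n : ℝ → ℝ) (x : ℝ) : ℂ := Complex.exp (-(Complex.I * ((k * Nint n x : ℝ) : ℂ)))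

/-- `r = μ ξ + ν ξ^{-1}`. -/
def rayFun (k : ℝ) (n : ℝ → ℝ) (μ ν : ℝ → ℂ) (x : ℝ) : ℂ :=
  μ x * xiF k n x + ν x * xiInv k n x

/-- The right boundary operator `B_R v = v'(1) - i k n_∞ v(1)`. -/
def BR (k nInf : ℝ) (v : ℝ → ℂ) : ℂ := deriv v 1 - Complex.I * (k : ℂ) * (nInf : ℂ) * v 1

end

theorem hasDerivAt_Nint {n : ℝ → ℝ} (hn : Continuous n) (x : ℝ) :
    HasDerivAt (Nint n) (n x) x :=
  intervalIntegral.integral_hasDerivAt_right (hn.intervalIntegrable _ _)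
    (hn.stronglyMeasurableAtFilter _ _) hn.continuousAt

theorem hasDerivAt_xiF (k : ℝ) {n : ℝ → ℝ} (hn : Continuous n) (x : ℝ) :
    HasDerivAt (xiF k n) (Complex.I * k * n x * xiF k n x) x := by
  have h := ((((hasDerivAt_Nint hn x).const_mul k).ofReal_comp).const_mul Complex.I).cexp
  refine h.congr_deriv ?_
  simp only [xiF]
  push_cast
  ring

theorem hasDerivAt_xiInv (k : ℝ) {n : ℝ → ℝ} (hn : Continuous n) (x : ℝ) :
    HasDerivAt (xiInv k n) (-(Complex.I * k) * n x * xiInv k n x) x := by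
  have h := ((((hasDerivAt_Nint hn x).const_mul k).ofReal_comp).const_mul Complex.I).neg.cexp
  refine h.congr_deriv ?_
  simp only [xiInv, Pi.neg_apply]
  push_cast
  ring

theorem ContDiff.hasDerivAt_deriv_of_two {f : ℝ → ℂ} (hf : ContDiff ℝ 2 f) (x : ℝ) :
    HasDerivAt (deriv f) (deriv (deriv f) x) x :=
  ((hf.differentiable_deriv_two) x).hasDerivAt

/-- First derivative of an amplitude times a phase with `E' = c n E`. -/
theorem hasDerivAt_amplitude_mul_phase {f E : ℝ → ℂ} {n : ℝ → ℝ} {c : ℂ}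
    (hf : ContDiff ℝ 2 f) (hE : ∀ x, HasDerivAt E (c * n x * E x) x) (x : ℝ) :
    HasDerivAt (fun y => f y * E y) ((deriv f x + c * n x * f x) * E x) x :=
  (((hf.differentiable two_ne_zero) x).hasDerivAt.mul (hE x)).congr_deriv (by ring)

/-- Second derivative of an amplitude times a phase with `E' = c n E`. -/
theorem hasDerivAt_deriv_amplitude_mul_phase {f E : ℝ → ℂ} {n : ℝ → ℝ} {c : ℂ}
    (hn : ContDiff ℝ 1 n) (hf : ContDiff ℝ 2 f)
    (hE : ∀ x, HasDerivAt E (c * n x * E x) x) (x : ℝ) :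
    HasDerivAt (fun y => (deriv f y + c * n y * f y) * E y)
      ((deriv (deriv f) x + c * (2 * n x * deriv f x + (deriv n x : ℝ) * f x) +
        c ^ 2 * (n x : ℂ) ^ 2 * f x) * E x) x := by
  have h0 := ((hf.differentiable two_ne_zero) x).hasDerivAt
  have hn' := (((hn.differentiable one_ne_zero) x).hasDerivAt.ofReal_comp).const_mul c
  exact (((hf.hasDerivAt_deriv_of_two x).add (hn'.mul h0)).mul (hE x)).congr_deriv
    (by simp only [Pi.add_apply, Pi.mul_apply]; ring)

/-- The Helmholtz operator applied to a linear combination of ray functions. -/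
theorem deriv_deriv_sum_rayFun (k : ℝ) {n : ℝ → ℝ} (hn : ContDiff ℝ 1 n) {μ ν : ℕ → ℝ → ℂ}
    {s : Finset ℕ} (hμ : ∀ j ∈ s, ContDiff ℝ 2 (μ j)) (hν : ∀ j ∈ s, ContDiff ℝ 2 (ν j))
    (a : ℕ → ℂ) (x : ℝ) :
    deriv (deriv (fun y => ∑ j ∈ s, a j * rayFun k n (μ j) (ν j) y)) x +
        (k : ℂ) ^ 2 * (n x : ℂ) ^ 2 * (∑ j ∈ s, a j * rayFun k n (μ j) (ν j) x) =
      ∑ j ∈ s, a j *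
        ((deriv (deriv (μ j)) x + Complex.I * k *
            (2 * n x * deriv (μ j) x + (deriv n x : ℝ) * μ j x)) * xiF k n x +
          (deriv (deriv (ν j)) x - Complex.I * k *
            (2 * n x * deriv (ν j) x + (deriv n x : ℝ) * ν j x)) * xiInv k n x) := by
  have hF := hasDerivAt_xiF k hn.continuous
  have hI := hasDerivAt_xiInv k hn.continuous
  have h1 : deriv (fun y => ∑ j ∈ s, a j * rayFun k n (μ j) (ν j) y) = fun y =>
      ∑ j ∈ s, a j * ((deriv (μ j) y + Complex.I * k * n y * μ j y) * xiF k n y +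
        (deriv (ν j) y + -(Complex.I * k) * n y * ν j y) * xiInv k n y) := by
    funext y
    exact (HasDerivAt.fun_sum fun j hj =>
      ((hasDerivAt_amplitude_mul_phase (hμ j hj) hF y).add
        (hasDerivAt_amplitude_mul_phase (hν j hj) hI y)).const_mul (a j)).deriv
  have h2 := HasDerivAt.fun_sum fun j hj =>
    ((hasDerivAt_deriv_amplitude_mul_phase hn (hμ j hj) hF x).add
      (hasDerivAt_deriv_amplitude_mul_phase hn (hν j hj) hI x)).const_mul (a j)
  rw [h1]
  refine (congrArg (· + _) h2.deriv).trans ?_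
  rw [Finset.mul_sum, ← Finset.sum_add_distrib]
  refine Finset.sum_congr rfl fun j _ => ?_
  simp only [rayFun]
  linear_combination (a j * (k : ℂ) ^ 2 * (n x : ℂ) ^ 2 *
    (μ j x * xiF k n x + ν j x * xiInv k n x)) * Complex.I_sq

/-- Telescoping of the weighted differences `u j - k u (j - 1)`. -/
theorem sum_inv_pow_mul_sub_telescope {k : ℂ} (hk : k ≠ 0) (u : ℕ → ℂ) (M : ℕ) :
    ∑ j ∈ Finset.range (M + 1), (k ^ j)⁻¹ * (u j - k * (if j = 0 then 0 else u (j - 1))) =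
      (k ^ M)⁻¹ * u M := by
  induction M with
  | zero => simp
  | succ M ih =>
    rw [Finset.sum_range_succ, ih]
    simp only [Nat.add_eq_zero_iff, one_ne_zero, and_false, if_false, Nat.add_sub_cancel]
    field_simp
    ring

/-- equation (5.9) of the paper: if `μ_j, ν_j` satisfy the transport
recurrences `2nμ_j' + n'μ_j = iμ_{j-1}''`, `2nν_j' + n'ν_j = -iν_{j-1}''` (with
`μ_{-1} = ν_{-1} = 0`) on `[0,1]`, then
`L(Σ_{j=0}^{2m} k^{-j} r_j) = k^{-2m}(μ_{2m}'' ξ + ν_{2m}'' ξ^{-1})` on `[0,1]`. -/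
theorem ray_expansion_residual (k : ℝ) (hk : 0 < k)
    (n : ℝ → ℝ) (hn : ContDiff ℝ 1 n) (m : ℕ) (μ ν : ℕ → ℝ → ℂ)
    (hμs : ∀ j ≤ 2 * m, ContDiff ℝ 2 (μ j)) (hνs : ∀ j ≤ 2 * m, ContDiff ℝ 2 (ν j))
    (hμrec : ∀ j ≤ 2 * m, ∀ x ∈ Set.Icc (0 : ℝ) 1,
        2 * (n x : ℂ) * deriv (μ j) x + ((deriv n x : ℝ) : ℂ) * μ j x =
          Complex.I * (if j = 0 then 0 else deriv (deriv (μ (j - 1))) x))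
    (hνrec : ∀ j ≤ 2 * m, ∀ x ∈ Set.Icc (0 : ℝ) 1,
        2 * (n x : ℂ) * deriv (ν j) x + ((deriv n x : ℝ) : ℂ) * ν j x =
          -(Complex.I * (if j = 0 then 0 else deriv (deriv (ν (j - 1))) x))) :
    ∀ x ∈ Set.Icc (0 : ℝ) 1,
      deriv (deriv (fun y => ∑ j ∈ Finset.range (2 * m + 1),
          ((k : ℂ) ^ j)⁻¹ * rayFun k n (μ j) (ν j) y)) x +
        (k : ℂ) ^ 2 * ((n x : ℂ)) ^ 2 *
          (∑ j ∈ Finset.range (2 * m + 1), ((k : ℂ) ^ j)⁻¹ * rayFun k n (μ j) (ν j) x) =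
      ((k : ℂ) ^ (2 * m))⁻¹ *
        (deriv (deriv (μ (2 * m))) x * xiF k n x + deriv (deriv (ν (2 * m))) x * xiInv k n x) := by
  intro x hx
  have hle : ∀ j ∈ Finset.range (2 * m + 1), j ≤ 2 * m := fun j hj =>
    Nat.lt_succ_iff.mp (Finset.mem_range.mp hj)
  rw [deriv_deriv_sum_rayFun k hn (fun j hj => hμs j (hle j hj)) (fun j hj => hνs j (hle j hj)),
    ← sum_inv_pow_mul_sub_telescope (Complex.ofReal_ne_zero.mpr hk.ne')
      (fun j => deriv (deriv (μ j)) x * xiF k n x + deriv (deriv (ν j)) x * xiInv k n x)]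
  refine Finset.sum_congr rfl fun j hj => ?_
  rw [hμrec j (hle j hj) x hx, hνrec j (hle j hj) x hx]
  congr 1
  split_ifs
  · ring
  · linear_combination (k * (deriv (deriv (μ (j - 1))) x * xiF k n x +
      deriv (deriv (ν (j - 1))) x * xiInv k n x)) * Complex.I_sq
end

section
/- Let k > 0, n ∈ C[0,1] nowhere vanishing, m ≥ 1, and F : [0,1] → ℂ with F ∈ C^{2m}[0,1]. Define F_2 = F/n² and F_{2j+2} = −F_{2j}''/n² for j = 1,…,m (assuming each F_{2j} is twice differentiable, which holds when n ∈ C^{2m}[0,1]). Then on [0,1], (Σ_{j=1}^{m} k^{-2j} F_{2j})'' + k² n² (Σ_{j=1}^{m} k^{-2j} F_{2j}) = F − k^{-2m} n² F_{2m+2}. -/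
open MeasureTheory

/-- The second derivative commutes with finite linear combinations of `C²` functions. -/
theorem deriv_deriv_sum_const_mul {ι : Type*} (s : Finset ι) (c : ι → ℂ) (f : ι → ℝ → ℂ)
    (hf : ∀ i ∈ s, ContDiff ℝ 2 (f i)) (x : ℝ) :
    deriv (deriv (fun y => ∑ i ∈ s, c i * f i y)) x = ∑ i ∈ s, c i * deriv (deriv (f i)) x := by
  have hd : ∀ i ∈ s, Differentiable ℝ (f i) := fun i hi => (hf i hi).differentiable (by norm_num)
  have hdd : ∀ i ∈ s, Differentiable ℝ (deriv (f i)) := fun i hi =>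
    (hf i hi).differentiable_deriv_two
  have h1 : deriv (fun y => ∑ i ∈ s, c i * f i y) = fun y => ∑ i ∈ s, c i * deriv (f i) y := by
    funext y
    rw [deriv_fun_sum fun i hi => ((hd i hi) y).const_mul (c i)]
    exact Finset.sum_congr rfl fun i hi => deriv_const_mul (c i) ((hd i hi) y)
  rw [h1, deriv_fun_sum fun i hi => ((hdd i hi) x).const_mul (c i)]
  exact Finset.sum_congr rfl fun i hi => deriv_const_mul (c i) ((hdd i hi) x)

/-- Telescoping of `∑ k^{-2j} (k² a_j - a_{j+1})`. -/
theorem sum_inv_pow_mul_telescope (k : ℂ) (hk : k ≠ 0) (a : ℕ → ℂ) (m : ℕ) :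
    ∑ j ∈ Finset.Icc 1 m, (k ^ (2 * j))⁻¹ * (k ^ 2 * a j - a (j + 1)) =
      a 1 - (k ^ (2 * m))⁻¹ * a (m + 1) := by
  induction m with
  | zero => simp
  | succ m ih =>
    rw [Finset.sum_Icc_succ_top (by omega), ih, mul_add, pow_add]
    field_simp
    ring

/-- equation (5.14) of the paper: with `F_2 = F/n²` and
`F_{2j+2} = -F_{2j}''/n²` (here `G j` plays the role of `F_{2j}`),
`L(Σ_{j=1}^m k^{-2j} F_{2j}) = F - k^{-2m} n² F_{2m+2}` on `[0,1]`. -/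
theorem particular_expansion_residual (k : ℝ) (hk : 0 < k)
    (n : ℝ → ℝ) (hncont : Continuous n) (hn : ∀ x ∈ Set.Icc (0 : ℝ) 1, n x ≠ 0)
    (m : ℕ) (hm : 1 ≤ m) (F : ℝ → ℂ) (hF : ContDiffOn ℝ (2 * m) F (Set.Icc (0 : ℝ) 1))
    (G : ℕ → ℝ → ℂ)
    (hGs : ∀ j, 1 ≤ j → j ≤ m → ContDiff ℝ 2 (G j))
    (hG1 : ∀ x ∈ Set.Icc (0 : ℝ) 1, G 1 x = F x / ((n x : ℂ)) ^ 2)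
    (hGrec : ∀ j, 1 ≤ j → j ≤ m → ∀ x ∈ Set.Icc (0 : ℝ) 1,
        G (j + 1) x = -(deriv (deriv (G j)) x) / ((n x : ℂ)) ^ 2) :
    ∀ x ∈ Set.Icc (0 : ℝ) 1,
      deriv (deriv (fun y => ∑ j ∈ Finset.Icc 1 m, ((k : ℂ) ^ (2 * j))⁻¹ * G j y)) x +
        (k : ℂ) ^ 2 * ((n x : ℂ)) ^ 2 *
          (∑ j ∈ Finset.Icc 1 m, ((k : ℂ) ^ (2 * j))⁻¹ * G j x) =
      F x - ((k : ℂ) ^ (2 * m))⁻¹ * ((n x : ℂ)) ^ 2 * G (m + 1) x := by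
  intro x hx
  have hn' : (n x : ℂ) ≠ 0 := by exact_mod_cast hn x hx
  have hk' : (k : ℂ) ≠ 0 := by exact_mod_cast hk.ne'
  have hF1 : F x = (n x : ℂ) ^ 2 * G 1 x := by
    rw [hG1 x hx]
    field_simp
  rw [deriv_deriv_sum_const_mul _ _ _ fun j hj =>
      hGs j (Finset.mem_Icc.1 hj).1 (Finset.mem_Icc.1 hj).2,
    hF1, mul_assoc (_⁻¹), ← sum_inv_pow_mul_telescope k hk' (fun j => (n x : ℂ) ^ 2 * G j x) m,
    Finset.mul_sum, ← Finset.sum_add_distrib]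
  refine Finset.sum_congr rfl fun j hj => ?_
  rw [hGrec j (Finset.mem_Icc.1 hj).1 (Finset.mem_Icc.1 hj).2 x hx]
  field_simp
  ring
end
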